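/- arXiv:2303.01334 — 4 statements merged into one kernel-verified Lean document; each statement's English description precedes it below -/
import Mathlib

section
/- Let P be a partially ordered set. For every k-tuple 𝔸 = (A₁,…,A_k) of subsets of P one has τ(β(𝔸)) = β(τ(𝔸)), and both are equal to the tuple (D₁,…,D_k) where D_i = {p ∈ A_i : there exists a thread (p₁,…,p_k) of 𝔸 with p_i = p}. -/
/-!
`τ` and `β` are as in the paper (tuples encoded as `A : ℕ → Set P` of length
`k`, `β` implemented by the forward recursion on the reversed tuple).
A *thread* of `(A₁,…,A_k)` is a tuple `(a₁,…,a_k)` with `a_i ∈ A_i` and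
`a₁ ≥ a₂ ≥ … ≥ a_k`, encoded as `f : ℕ → P` with `f i ∈ A i` for `i < k` and
`f (i+1) ≤ f i` for `i + 1 < k`.

STATEMENT: `τ(β(𝔸)) = β(τ(𝔸))`, and both equal the tuple `(D₁,…,D_k)` where
`D_i = {p ∈ A_i : there exists a thread (p₁,…,p_k) of 𝔸 with p_i = p}`.
-/

def lowSet {P : Type*} [PartialOrder P] (S : Set P) : Set P :=
  {p | ∃ s ∈ S, p ≤ s}

def upSet {P : Type*} [PartialOrder P] (S : Set P) : Set P :=
  {p | ∃ s ∈ S, s ≤ p}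

def tauF {P : Type*} [PartialOrder P] (A : ℕ → Set P) : ℕ → Set P
  | 0 => A 0
  | n + 1 => A (n + 1) ∩ lowSet (tauF A n)

def tauUpF {P : Type*} [PartialOrder P] (A : ℕ → Set P) : ℕ → Set P
  | 0 => A 0
  | n + 1 => A (n + 1) ∩ upSet (tauUpF A n)

def betaF {P : Type*} [PartialOrder P] (k : ℕ) (A : ℕ → Set P) : ℕ → Set P :=
  fun i => tauUpF (fun j => A (k - 1 - j)) (k - 1 - i)

def IsThread {P : Type*} [PartialOrder P] (k : ℕ) (A : ℕ → Set P)
    (f : ℕ → P) : Prop :=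
  (∀ i < k, f i ∈ A i) ∧ ∀ i, i + 1 < k → f (i + 1) ≤ f i

theorem tauF_subset {P : Type*} [PartialOrder P] (A : ℕ → Set P) (n : ℕ) :
    tauF A n ⊆ A n := by
  cases n with
  | zero => exact subset_rfl
  | succ n => exact Set.inter_subset_left

theorem betaF_last {P : Type*} [PartialOrder P] (n : ℕ) (A : ℕ → Set P) :
    betaF (n + 1) A n = A n := by
  simp [betaF, tauUpF]

theorem betaF_of_succ_lt {P : Type*} [PartialOrder P] {k i : ℕ} (A : ℕ → Set P)
    (h : i + 1 < k) : betaF k A i = A i ∩ upSet (betaF k A (i + 1)) := by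
  obtain ⟨d, rfl⟩ : ∃ d, k = i + d + 2 := ⟨k - i - 2, by omega⟩
  have h₁ : i + d + 2 - 1 - i = d + 1 := by omega
  have h₂ : i + d + 2 - 1 - (i + 1) = d := by omega
  have h₃ : i + d + 2 - 1 - (d + 1) = i := by omega
  simp only [betaF, h₁, h₂, tauUpF, h₃]

/-- Downward induction on the positions of a tuple of length `k`. -/
theorem induction_from_last {k : ℕ} {motive : ∀ i, i < k → Prop}
    (last : ∀ n, ∀ h : k = n + 1, motive n (by omega))
    (step : ∀ i, ∀ h : i + 1 < k, motive (i + 1) h → motive i (by omega)) {i : ℕ}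
    (hi : i < k) : motive i hi := by
  obtain ⟨d, hd⟩ : ∃ d, k = i + d + 1 := ⟨k - i - 1, by omega⟩
  induction d generalizing i with
  | zero => exact last i hd
  | succ d ih => exact step i (by omega) (ih (by omega) (by omega))

theorem betaF_subset {P : Type*} [PartialOrder P] {k i : ℕ} (A : ℕ → Set P)
    (hi : i < k) : betaF k A i ⊆ A i := by
  rcases (show i + 1 ≤ k from hi).eq_or_lt with rfl | h
  · exact (betaF_last i A).subset
  · rw [betaF_of_succ_lt A h]
    exact Set.inter_subset_left

theorem tauF_betaF {P : Type*} [PartialOrder P] {k : ℕ} (A : ℕ → Set P) {i : ℕ}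
    (hi : i < k) : tauF (betaF k A) i = tauF A i ∩ betaF k A i := by
  induction i with
  | zero => exact (Set.inter_eq_right.2 (betaF_subset A hi)).symm
  | succ i ih =>
    ext p
    simp only [tauF, ih (by omega)]
    constructor
    · rintro ⟨hp, s, hs, hps⟩
      exact ⟨⟨betaF_subset A hi hp, s, hs.1, hps⟩, hp⟩
    · rintro ⟨⟨-, s, hs, hps⟩, hp⟩
      refine ⟨hp, s, ⟨hs, ?_⟩, hps⟩
      rw [betaF_of_succ_lt A hi]
      exact ⟨tauF_subset A i hs, p, hp, hps⟩

theorem betaF_tauF {P : Type*} [PartialOrder P] {k : ℕ} (A : ℕ → Set P) {i : ℕ}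
    (hi : i < k) : betaF k (tauF A) i = tauF A i ∩ betaF k A i := by
  induction hi using induction_from_last with
  | last n hn =>
    subst hn
    rw [betaF_last, betaF_last, Set.inter_eq_left.2 (tauF_subset A n)]
  | step i hi ih =>
    ext p
    rw [betaF_of_succ_lt _ hi, betaF_of_succ_lt _ hi, ih]
    constructor
    · rintro ⟨hp, s, hs, hsp⟩
      exact ⟨hp, tauF_subset A i hp, s, hs.2, hsp⟩
    · rintro ⟨hp, -, s, hs, hsp⟩
      exact ⟨hp, s, ⟨⟨betaF_subset A hi hs, p, hp, hsp⟩, hs⟩, hsp⟩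

theorem exists_chain_of_mem_tauF {P : Type*} [PartialOrder P] {A : ℕ → Set P}
    {n : ℕ} {p : P} (hp : p ∈ tauF A n) :
    ∃ f : ℕ → P, f n = p ∧ (∀ j ≤ n, f j ∈ A j) ∧ ∀ j < n, f (j + 1) ≤ f j := by
  induction n generalizing p with
  | zero =>
    refine ⟨fun _ => p, rfl, fun j hj => ?_, fun j hj => by omega⟩
    obtain rfl : j = 0 := by omega
    exact hp
  | succ n ih =>
    obtain ⟨hpA, s, hs, hps⟩ := hp
    obtain ⟨f, rfl, hfA, hf⟩ := ih hs
    refine ⟨fun j => if j ≤ n then f j else p, by simp, fun j hj => ?_, fun j hj => ?_⟩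
    · grind
    · grind

theorem exists_chain_of_mem_betaF {P : Type*} [PartialOrder P] {k : ℕ}
    {A : ℕ → Set P} {i : ℕ} (hi : i < k) {p : P} (hp : p ∈ betaF k A i) :
    ∃ f : ℕ → P, f i = p ∧ (∀ j, i ≤ j → j < k → f j ∈ A j) ∧
      ∀ j, i ≤ j → j + 1 < k → f (j + 1) ≤ f j := by
  induction hi using induction_from_last generalizing p with
  | last n hn =>
    subst hn
    rw [betaF_last] at hp
    refine ⟨fun _ => p, rfl, fun j hj hj' => ?_, fun j hj hj' => by omega⟩
    obtain rfl : j = n := by omega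
    exact hp
  | step i hi ih =>
    rw [betaF_of_succ_lt A hi] at hp
    obtain ⟨hpA, s, hs, hsp⟩ := hp
    obtain ⟨f, rfl, hfA, hf⟩ := ih hs
    refine ⟨fun j => if j ≤ i then p else f j, by simp, fun j hj hj' => ?_,
      fun j hj hj' => ?_⟩
    · grind
    · grind

theorem IsThread.mem_tauF {P : Type*} [PartialOrder P] {k : ℕ} {A : ℕ → Set P}
    {f : ℕ → P} (hf : IsThread k A f) {i : ℕ} (hi : i < k) : f i ∈ tauF A i := by
  induction i with
  | zero => exact hf.1 0 hi
  | succ i ih => exact ⟨hf.1 _ hi, f i, ih (by omega), hf.2 i hi⟩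

theorem IsThread.mem_betaF {P : Type*} [PartialOrder P] {k : ℕ} {A : ℕ → Set P}
    {f : ℕ → P} (hf : IsThread k A f) {i : ℕ} (hi : i < k) : f i ∈ betaF k A i := by
  induction hi using induction_from_last with
  | last n hn =>
    subst hn
    rw [betaF_last]
    exact hf.1 n (by omega)
  | step i hi ih =>
    rw [betaF_of_succ_lt A hi]
    exact ⟨hf.1 i (by omega), f (i + 1), ih, hf.2 i hi⟩

theorem stmt_3 {P : Type*} [PartialOrder P] (k : ℕ) (A : ℕ → Set P)
    (i : ℕ) (hi : i < k) :
    tauF (betaF k A) i = betaF k (tauF A) i ∧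
    tauF (betaF k A) i =
      {p | p ∈ A i ∧ ∃ f : ℕ → P, IsThread k A f ∧ f i = p} := by
  refine ⟨(tauF_betaF A hi).trans (betaF_tauF A hi).symm, ?_⟩
  rw [tauF_betaF A hi]
  ext p
  constructor
  · rintro ⟨hp, hp'⟩
    obtain ⟨f, hfp, hfA, hf⟩ := exists_chain_of_mem_tauF hp
    obtain ⟨g, hgp, hgA, hg⟩ := exists_chain_of_mem_betaF hi hp'
    refine ⟨tauF_subset A i hp, fun j => if j ≤ i then f j else g j,
      ⟨fun j hj => ?_, fun j hj => ?_⟩, by simpa using hfp⟩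
    · grind
    · grind
  · rintro ⟨-, f, hf, rfl⟩
    exact ⟨hf.mem_tauF hi, hf.mem_betaF hi⟩
end

section
/- Let P be a partially ordered set. There exists a unique function γ from finite nonempty tuples of subsets of P to finite nonempty tuples of subsets of P such that: (a) γ(𝔸) is collapsed for every tuple 𝔸, and γ(𝔸) = 𝔸 whenever 𝔸 is collapsed; (b) γ(A₁,…,A_k) = γ(A₁,…,A_{i−2},A_i,A_{i+1},…,A_k) (the entry A_{i−1} is deleted) whenever A_i ⊆ A_{i−1}; (c) γ(A₁,…,A_k) = γ(A₁,…,A_{i−1},A_i,A_{i+2},…,A_k) (the entry A_{i+1} is deleted) whenever A_i ⊆ A_{i+1}. In particular, every tuple can be reduced in finitely many such deletion steps to a collapsed tuple, and the resulting collapsed tuple is independent of the order in which the deletions are performed. -/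
/-!
Finite nonempty tuples of subsets of `P` are encoded as nonempty lists
`l : List (Set P)`.  A tuple `(A₁,…,A_k)` is *collapsed* if for every
`1 ≤ i ≤ k−1` neither `A_i ⊆ A_{i+1}` nor `A_{i+1} ⊆ A_i`.
`DelStep` is the elementary deletion step: if `A_i ⊆ A_{i−1}` delete
`A_{i−1}`, and if `A_i ⊆ A_{i+1}` delete `A_{i+1}`.

STATEMENT: there exists a unique function `γ` on nonempty tuples such that
(a) `γ(𝔸)` is collapsed for every `𝔸` and `γ(𝔸) = 𝔸` whenever `𝔸` is
collapsed; (b) `γ` is unchanged by deleting an entry `A_{i−1}` with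
`A_i ⊆ A_{i−1}`; (c) `γ` is unchanged by deleting an entry `A_{i+1}` with
`A_i ⊆ A_{i+1}`.  In particular every tuple is reduced in finitely many such
deletion steps to a collapsed tuple, and the resulting collapsed tuple is
independent of the order of the deletions.
-/

def Collapsed {P : Type*} (l : List (Set P)) : Prop :=
  l.Chain' fun A B => ¬A ⊆ B ∧ ¬B ⊆ A

inductive DelStep {P : Type*} : List (Set P) → List (Set P) → Prop
  | left (l₁ l₂ : List (Set P)) (A B : Set P) (h : A ⊆ B) :
      DelStep (l₁ ++ B :: A :: l₂) (l₁ ++ A :: l₂)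
  | right (l₁ l₂ : List (Set P)) (A B : Set P) (h : A ⊆ B) :
      DelStep (l₁ ++ A :: B :: l₂) (l₁ ++ A :: l₂)

def GoodGamma {P : Type*} (γ : List (Set P) → List (Set P)) : Prop :=
  (∀ l, l ≠ [] → Collapsed (γ l)) ∧
  (∀ l, l ≠ [] → Collapsed l → γ l = l) ∧
  (∀ l₁ l₂ : List (Set P), ∀ A B : Set P, A ⊆ B →
    γ (l₁ ++ B :: A :: l₂) = γ (l₁ ++ A :: l₂)) ∧
  (∀ l₁ l₂ : List (Set P), ∀ A B : Set P, A ⊆ B →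
    γ (l₁ ++ A :: B :: l₂) = γ (l₁ ++ A :: l₂))

open Classical in
/-- Normal form of `A :: l` under deletion steps, for `l` collapsed. -/
noncomputable def pushCollapse {P : Type*} (A : Set P) : List (Set P) → List (Set P)
  | [] => [A]
  | B :: l => if A ⊆ B then pushCollapse A l else if B ⊆ A then B :: l else A :: B :: l

/-- The collapsed tuple obtained from `l` by inserting its entries from right to left. -/
noncomputable def collapse {P : Type*} (l : List (Set P)) : List (Set P) :=
  l.foldr pushCollapse []

section

variable {P : Type*}

theorem Collapsed.of_cons {A : Set P} {l : List (Set P)} (h : Collapsed (A :: l)) :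
    Collapsed l :=
  List.IsChain.tail h

theorem Collapsed.pushCollapse_eq {A : Set P} {l : List (Set P)} (h : Collapsed (A :: l)) :
    pushCollapse A l = A :: l := by
  cases l with
  | nil => rfl
  | cons B l =>
    obtain ⟨⟨h₁, h₂⟩, -⟩ := List.isChain_cons_cons.1 h
    simp [pushCollapse, h₁, h₂]

theorem exists_pushCollapse_eq_cons (A : Set P) (l : List (Set P)) :
    ∃ H t, pushCollapse A l = H :: t ∧ H ⊆ A := by
  induction l with
  | nil => exact ⟨A, [], rfl, subset_rfl⟩
  | cons B l ih =>
    unfold pushCollapse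
    split_ifs with h₁ h₂
    · exact ih
    · exact ⟨B, l, rfl, h₂⟩
    · exact ⟨A, B :: l, rfl, subset_rfl⟩

theorem Collapsed.pushCollapse {l : List (Set P)} (h : Collapsed l) (A : Set P) :
    Collapsed (pushCollapse A l) := by
  induction l with
  | nil => exact List.isChain_singleton A
  | cons B l ih =>
    unfold _root_.pushCollapse
    split_ifs with h₁ h₂
    · exact ih h.of_cons
    · exact h
    · exact List.isChain_cons_cons.2 ⟨⟨h₁, h₂⟩, h⟩

theorem pushCollapse_pushCollapse_of_superset {A B : Set P} (hAB : A ⊆ B) {l : List (Set P)}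
    (hl : Collapsed l) : pushCollapse B (pushCollapse A l) = pushCollapse A l := by
  have hc := hl.pushCollapse A
  obtain ⟨H, t, heq, hH⟩ := exists_pushCollapse_eq_cons A l
  rw [heq] at hc ⊢
  by_cases hBH : B ⊆ H
  · obtain rfl : B = H := hBH.antisymm (hH.trans hAB)
    rw [pushCollapse, if_pos subset_rfl, hc.pushCollapse_eq]
  · rw [pushCollapse, if_neg hBH, if_pos (hH.trans hAB)]

theorem pushCollapse_pushCollapse_of_subset {A B : Set P} (hAB : A ⊆ B) (l : List (Set P)) :
    pushCollapse A (pushCollapse B l) = pushCollapse A l := by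
  induction l with
  | nil => simp [pushCollapse, hAB]
  | cons C l ih =>
    by_cases h₁ : B ⊆ C
    · simp [pushCollapse, h₁, hAB.trans h₁, ih]
    · by_cases h₂ : C ⊆ B
      · rw [pushCollapse.eq_2 B, if_neg h₁, if_pos h₂]
      · rw [pushCollapse.eq_2 B, if_neg h₁, if_neg h₂, pushCollapse.eq_2 A B, if_pos hAB]

theorem collapsed_collapse (l : List (Set P)) : Collapsed (collapse l) := by
  induction l with
  | nil => exact List.isChain_nil
  | cons A l ih => exact ih.pushCollapse A

theorem Collapsed.collapse_eq {l : List (Set P)} (h : Collapsed l) : collapse l = l := by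
  induction l with
  | nil => rfl
  | cons A l ih =>
    change _root_.pushCollapse A (collapse l) = A :: l
    rw [ih h.of_cons, h.pushCollapse_eq]

theorem collapse_ne_nil {l : List (Set P)} (h : l ≠ []) : collapse l ≠ [] := by
  cases l with
  | nil => exact absurd rfl h
  | cons A l =>
    obtain ⟨H, t, heq, -⟩ := exists_pushCollapse_eq_cons A (collapse l)
    exact ne_of_eq_of_ne heq (List.cons_ne_nil H t)

theorem DelStep.collapse_eq {l m : List (Set P)} (h : DelStep l m) : collapse l = collapse m := by
  cases h with
  | left l₁ l₂ A B h =>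
    simp only [collapse, List.foldr_append, List.foldr_cons]
    exact congrArg (List.foldr pushCollapse · l₁)
      (pushCollapse_pushCollapse_of_superset h (collapsed_collapse l₂))
  | right l₁ l₂ A B h =>
    simp only [collapse, List.foldr_append, List.foldr_cons]
    rw [pushCollapse_pushCollapse_of_subset h]

theorem DelStep.cons {l m : List (Set P)} (h : DelStep l m) (A : Set P) :
    DelStep (A :: l) (A :: m) := by
  cases h with
  | left l₁ l₂ B C h => exact .left (A :: l₁) l₂ B C h
  | right l₁ l₂ B C h => exact .right (A :: l₁) l₂ B C h

theorem reflTransGen_delStep_pushCollapse (A : Set P) (l : List (Set P)) :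
    Relation.ReflTransGen DelStep (A :: l) (pushCollapse A l) := by
  induction l with
  | nil => exact .refl
  | cons B l ih =>
    unfold pushCollapse
    split_ifs with h₁ h₂
    · exact .head (.right [] l A B h₁) ih
    · exact .single (.left [] l B A h₂)
    · exact .refl

theorem reflTransGen_delStep_collapse (l : List (Set P)) :
    Relation.ReflTransGen DelStep l (collapse l) := by
  induction l with
  | nil => exact .refl
  | cons A l ih =>
    exact (ih.lift (A :: ·) fun _ _ h => h.cons A).trans
      (reflTransGen_delStep_pushCollapse A (collapse l))

theorem Relation.ReflTransGen.apply_eq_of_delStep {α : Type*} {f : List (Set P) → α}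
    (hf : ∀ l m, DelStep l m → f l = f m) {l m : List (Set P)}
    (h : Relation.ReflTransGen DelStep l m) : f l = f m := by
  induction h with
  | refl => rfl
  | tail _ hs ih => exact ih.trans (hf _ _ hs)

theorem GoodGamma.apply_eq_of_delStep {γ : List (Set P) → List (Set P)} (hγ : GoodGamma γ)
    (l m : List (Set P)) (h : DelStep l m) : γ l = γ m := by
  cases h with
  | left l₁ l₂ A B h => exact hγ.2.2.1 l₁ l₂ A B h
  | right l₁ l₂ A B h => exact hγ.2.2.2 l₁ l₂ A B h

theorem goodGamma_collapse : GoodGamma (collapse (P := P)) :=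
  ⟨fun l _ => collapsed_collapse l, fun _ _ h => h.collapse_eq,
    fun l₁ l₂ A B h => (DelStep.left l₁ l₂ A B h).collapse_eq,
    fun l₁ l₂ A B h => (DelStep.right l₁ l₂ A B h).collapse_eq⟩

end

theorem stmt_4 {P : Type*} :
    ∃ γ : List (Set P) → List (Set P), GoodGamma γ ∧
      (∀ γ' : List (Set P) → List (Set P), GoodGamma γ' →
        ∀ l, l ≠ [] → γ' l = γ l) ∧
      (∀ l : List (Set P), l ≠ [] →
        Relation.ReflTransGen DelStep l (γ l)) ∧
      (∀ l m : List (Set P), l ≠ [] →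
        Relation.ReflTransGen DelStep l m → Collapsed m → m = γ l) := by
  refine ⟨collapse, goodGamma_collapse, fun γ' hγ' l hl => ?_,
    fun l _ => reflTransGen_delStep_collapse l, fun l m _ hlm hm => ?_⟩
  · rw [(reflTransGen_delStep_collapse l).apply_eq_of_delStep hγ'.apply_eq_of_delStep]
    exact hγ'.2.1 _ (collapse_ne_nil hl) (collapsed_collapse l)
  · rw [hlm.apply_eq_of_delStep fun _ _ h => h.collapse_eq, hm.collapse_eq]
end

section
/- Let P be a partially ordered set of Krull dimension at most 1 (every chain of P has at most 2 elements) with greatest element t. Consider tuples of subsets of P of the following two forms: (i) 1-tuples (A) with A ⊆ P, and (ii) pairs ({t}∪C, D) with C, D ⊆ P∖{t} and C ⊊ D. If 𝔸 and 𝔹 are two tuples, each of one of these forms, and T(𝔸) = T(𝔹), then 𝔸 = 𝔹; in particular a 1-tuple and a pair of the above forms never have the same collection of thread sets. -/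
/-!
Let `P` be a poset of Krull dimension at most 1 (every chain has at most 2
elements, i.e. `x ≤ y ≤ z → x = y ∨ y = z`) with greatest element `t`.
Tuples of subsets are encoded as lists `l : List (Set P)`; a chain `T` is a
*thread set* for the tuple if the componentwise intersections with `T` admit
a descending thread, and the collection of thread sets is
`{T | ThreadSetL l T}`.  `Form t l` says that `l` is of one of the two
forms: (i) a 1-tuple `(A)` with `A ⊆ P`, or (ii) a pair `({t}∪C, D)` with
`C, D ⊆ P∖{t}` and `C ⊊ D`.

STATEMENT: if `𝔸` and `𝔹` are two tuples, each of one of these forms, and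
`T(𝔸) = T(𝔹)`, then `𝔸 = 𝔹`; in particular a 1-tuple and a pair of the
above forms never have the same collection of thread sets.
-/

def IsThreadL {P : Type*} [PartialOrder P] (l : List (Set P))
    (f : ℕ → P) : Prop :=
  (∀ i : Fin l.length, f i.val ∈ l.get i) ∧
    ∀ i, i + 1 < l.length → f (i + 1) ≤ f i

def ThreadSetL {P : Type*} [PartialOrder P] (l : List (Set P))
    (T : Set P) : Prop :=
  IsChain (· ≤ ·) T ∧ ∃ f : ℕ → P, IsThreadL (l.map fun A => T ∩ A) f

def Form {P : Type*} [PartialOrder P] (t : P) (l : List (Set P)) : Prop :=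
  (∃ A : Set P, l = [A]) ∨
  (∃ C D : Set P, C ⊂ D ∧ D ⊆ {p : P | p ≠ t} ∧ l = [{t} ∪ C, D])

theorem threadSetL_singleton_iff {P : Type*} [PartialOrder P] (A T : Set P) :
    ThreadSetL [A] T ↔ IsChain (· ≤ ·) T ∧ ∃ a ∈ T, a ∈ A := by
  refine and_congr_right fun _ => ⟨?_, ?_⟩
  · rintro ⟨f, hf, -⟩
    exact ⟨f 0, hf ⟨0, by simp⟩⟩
  · rintro ⟨a, ha⟩
    refine ⟨fun _ => a, fun i => ?_, fun _ _ => le_rfl⟩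
    obtain ⟨_ | n, hn⟩ := i
    · exact ha
    · simp at hn

theorem threadSetL_pair_iff {P : Type*} [PartialOrder P] (A B T : Set P) :
    ThreadSetL [A, B] T ↔
      IsChain (· ≤ ·) T ∧ ∃ a ∈ T, ∃ b ∈ T, a ∈ A ∧ b ∈ B ∧ b ≤ a := by
  refine and_congr_right fun _ => ⟨?_, ?_⟩
  · rintro ⟨f, hf, hle⟩
    obtain ⟨haT, haA⟩ := hf ⟨0, by simp⟩
    obtain ⟨hbT, hbB⟩ := hf ⟨1, by simp⟩
    exact ⟨f 0, haT, f 1, hbT, haA, hbB, hle 0 (by simp)⟩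
  · rintro ⟨a, haT, b, hbT, haA, hbB, hle⟩
    refine ⟨fun n => if n = 0 then a else b, fun i => ?_, fun i hi => ?_⟩
    · obtain ⟨_ | _ | n, hn⟩ := i
      · exact ⟨haT, haA⟩
      · exact ⟨hbT, hbB⟩
      · simp at hn
    · obtain rfl : i = 0 := by simpa using hi
      simpa using hle

/-- A one-point chain `{p}` detects membership in the single component. -/
theorem threadSetL_singleton_point {P : Type*} [PartialOrder P] (A : Set P) (p : P) :
    ThreadSetL [A] {p} ↔ p ∈ A := by
  simp [threadSetL_singleton_iff]

/-- A one-point chain `{p}` detects membership in both components. -/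
theorem threadSetL_pair_point {P : Type*} [PartialOrder P] (A B : Set P) (p : P) :
    ThreadSetL [A, B] {p} ↔ p ∈ A ∧ p ∈ B := by
  simp [threadSetL_pair_iff]

/-- The chain `{p, t}` with `t` the greatest element detects membership in the lower component. -/
theorem threadSetL_pair_top {P : Type*} [PartialOrder P] {t : P} (ht : ∀ p : P, p ≤ t)
    {C D : Set P} (htD : t ∉ D) (p : P) :
    ThreadSetL [{t} ∪ C, D] {p, t} ↔ p ∈ D := by
  rw [threadSetL_pair_iff]
  constructor
  · rintro ⟨-, a, -, b, rfl | rfl, -, hb, -⟩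
    · exact hb
    · exact absurd hb htD
  · intro hp
    exact ⟨IsChain.pair (ht p), t, by simp, p, by simp, by simp, hp, ht p⟩

/-- A 1-tuple and a pair `({t} ∪ C, D)` with `C ⊂ D` and `t ∉ D` have different thread sets. -/
theorem threadSetL_singleton_ne_pair {P : Type*} [PartialOrder P] {t : P}
    (ht : ∀ p : P, p ≤ t) {A C D : Set P} (hCD : C ⊂ D) (htD : t ∉ D) :
    ¬ ∀ T : Set P, ThreadSetL [A] T ↔ ThreadSetL [{t} ∪ C, D] T := by
  intro h
  have hpoint (p : P) : p ∈ A ↔ p ∈ {t} ∪ C ∧ p ∈ D := by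
    rw [← threadSetL_singleton_point, h, threadSetL_pair_point]
  obtain ⟨p, hpD, hpC⟩ := Set.exists_of_ssubset hCD
  have hpt := (h {p, t}).2 ((threadSetL_pair_top ht htD p).2 hpD)
  obtain ⟨-, a, rfl | rfl, haA⟩ := (threadSetL_singleton_iff _ _).1 hpt
  · obtain ⟨rfl | haC, -⟩ := (hpoint a).1 haA
    · exact htD hpD
    · exact hpC haC
  · exact htD ((hpoint a).1 haA).2

theorem stmt_13 {P : Type*} [PartialOrder P]
    (hdim : ∀ x y z : P, x ≤ y → y ≤ z → x = y ∨ y = z)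
    (t : P) (ht : ∀ p : P, p ≤ t)
    (l m : List (Set P)) (hl : Form t l) (hm : Form t m)
    (h : {T : Set P | ThreadSetL l T} = {T : Set P | ThreadSetL m T}) :
    l = m := by
  have h' (T : Set P) : ThreadSetL l T ↔ ThreadSetL m T := Set.ext_iff.1 h T
  obtain ⟨A, rfl⟩ | ⟨C, D, hCD, hD, rfl⟩ := hl <;>
    obtain ⟨B, rfl⟩ | ⟨C', D', hCD', hD', rfl⟩ := hm
  · have hAB : A = B := by
      ext p
      rw [← threadSetL_singleton_point, h', threadSetL_singleton_point]
    rw [hAB]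
  · exact (threadSetL_singleton_ne_pair ht hCD' (fun htD => hD' htD rfl) h').elim
  · exact (threadSetL_singleton_ne_pair ht hCD (fun htD => hD htD rfl) fun T => (h' T).symm).elim
  · have htD : t ∉ D := fun htD => hD htD rfl
    have htD' : t ∉ D' := fun htD => hD' htD rfl
    have hDD : D = D' := by
      ext p
      rw [← threadSetL_pair_top ht htD, h', threadSetL_pair_top ht htD']
    subst hDD
    have hCC : {t} ∪ C = {t} ∪ C' := by
      ext p
      have hp := h' {p}
      rw [threadSetL_pair_point, threadSetL_pair_point] at hp
      by_cases hpD : p ∈ D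
      · simpa [hpD] using hp
      · have hpC : p ∉ C := fun hpC => hpD (hCD.subset hpC)
        have hpC' : p ∉ C' := fun hpC => hpD (hCD'.subset hpC)
        simp [hpC, hpC']
    rw [hCC]
end

section
/- Let X be a T0, quasi-sober, noetherian topological space whose specialization order has Krull dimension at most 1; that is, there do not exist three pairwise distinct points x, y, z of X with y ∈ closure({x}) and z ∈ closure({y}). Let p and q be distinct points of X, each of which admits a proper specialization (there exists x ≠ p with x ∈ closure({p}), and there exists y ≠ q with y ∈ closure({q})). Then the intersection closure({p}) ∩ closure({q}) is a finite set. -/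
/-!
STATEMENT: Let `X` be a T0, quasi-sober, noetherian topological space whose
specialization order has Krull dimension at most 1, i.e. there are no three
pairwise distinct points `x, y, z` with `y ∈ closure {x}` and
`z ∈ closure {y}`.  Let `p ≠ q` be points of `X`, each admitting a proper
specialization.  Then `closure {p} ∩ closure {q}` is a finite set.
-/

open TopologicalSpace in
/-- In a noetherian quasi-sober space, a closed set all of whose points are closed is finite. -/
theorem IsClosed.finite_of_forall_closure_singleton {X : Type*} [TopologicalSpace X]
    [QuasiSober X] [NoetherianSpace X] {s : Set X} (hs : IsClosed s)
    (h : ∀ z ∈ s, closure {z} ⊆ {z}) : s.Finite := by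
  obtain ⟨S, hSfin, hSclosed, hSirr, rfl⟩ :=
    NoetherianSpace.exists_finite_set_isClosed_irreducible hs
  refine hSfin.sUnion fun t ht => ?_
  obtain ⟨z, hz⟩ := QuasiSober.sober (hSirr t ht) (hSclosed t ht)
  refine (Set.finite_singleton z).subset ?_
  rw [← hz.def]
  exact h z ⟨t, ht, hz.mem⟩

/-- Mutually specializing points of a T0 space are equal. -/
theorem eq_of_mem_closure_singleton {X : Type*} [TopologicalSpace X] [T0Space X] {x y : X}
    (hxy : x ∈ closure {y}) (hyx : y ∈ closure {x}) : x = y :=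
  ((specializes_iff_mem_closure.2 hyx).antisymm (specializes_iff_mem_closure.2 hxy)).eq

theorem stmt_17 {X : Type*} [TopologicalSpace X] [T0Space X] [QuasiSober X]
    [TopologicalSpace.NoetherianSpace X]
    (hdim : ¬∃ x y z : X, x ≠ y ∧ y ≠ z ∧ x ≠ z ∧
      y ∈ closure {x} ∧ z ∈ closure {y})
    (p q : X) (hpq : p ≠ q)
    (hp : ∃ x, x ≠ p ∧ x ∈ closure {p})
    (hq : ∃ y, y ≠ q ∧ y ∈ closure {q}) :
    (closure {p} ∩ closure {q}).Finite := by
  have closed_of_ne {a z : X} (hza : z ≠ a) (hz : z ∈ closure {a}) : closure {z} ⊆ {z} := by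
    intro w hw
    by_contra hwz
    refine hdim ⟨a, z, w, hza.symm, Ne.symm hwz, ?_, hz, hw⟩
    rintro rfl
    exact hza (eq_of_mem_closure_singleton hz hw)
  refine (isClosed_closure.inter isClosed_closure).finite_of_forall_closure_singleton ?_
  rintro z ⟨hzp, hzq⟩
  by_cases h : z = p
  · exact closed_of_ne (h ▸ hpq) hzq
  · exact closed_of_ne h hzp
end
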